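/- arXiv:2604.06431 — 2 statements merged into one kernel-verified Lean document; each statement's English description precedes it below -/
import Mathlib

section
/- A bounded-degree element f of the supercommutative superspace algebra ℚ^θ[[x]] is a quasisymmetric function in superspace (i.e. its coefficient on a monomial depends only on the dotted composition of that monomial) if and only if σ · f = f for every σ in the finitary symmetric group S_∞ acting by the quasisymmetrizing action in superspace. -/
/-- A part of a dotted (pseudo-)composition: `Sum.inl a` is the non-dotted nonnegative
integer `a`, and `Sum.inr a` is the dotted nonnegative integer `ȧ`. -/
abbrev DPart := ℕ ⊕ ℕ

/-- A commutative superspace monomial: `S` records the indices of the anticommuting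
variables `θ` and `e` records the exponents of the commuting variables `x`. -/
structure SMon where
  S : Finset ℕ
  e : ℕ →₀ ℕ

namespace SMon

/-- The set of indices of a commutative superspace monomial. -/
def ind (u : SMon) : Finset ℕ := u.S ∪ u.e.support

/-- The dotted composition associated with a commutative superspace monomial: reading the
index set increasingly, the part at index `a` is the exponent `e a`, dotted iff `a ∈ S`. -/
def dcomp (u : SMon) : List DPart :=
  (u.ind.sort (· ≤ ·)).map fun a => if a ∈ u.S then Sum.inr (u.e a) else Sum.inl (u.e a)

/-- The total degree of a commutative superspace monomial. -/
def deg (u : SMon) : ℕ := u.S.card + u.e.sum fun _ n => n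

end SMon

/-- The quasisymmetrizing action in superspace of the simple transposition `s_i`
(swapping `i` and `i+1`) on monomials: in the associated dotted pseudo-composition
(padded with trailing non-dotted zeros), the entries in positions `i` and `i+1` are
interchanged when at least one of them is the non-dotted zero. -/
def sMon (i : ℕ) (u : SMon) : SMon :=
  if (i ∉ u.S ∧ u.e i = 0) ∨ ((i + 1) ∉ u.S ∧ u.e (i + 1) = 0) then
    ⟨u.S.image fun a => Equiv.swap i (i + 1) a,
      Finsupp.equivMapDomain (Equiv.swap i (i + 1)) u.e⟩
  else u

namespace SMon

/-- The part of the dotted pseudo-composition of `u` at position `a`. -/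
def part (u : SMon) (a : ℕ) : DPart := if a ∈ u.S then Sum.inr (u.e a) else Sum.inl (u.e a)

theorem dcomp_eq_map_part (u : SMon) : u.dcomp = (u.ind.sort (· ≤ ·)).map u.part := rfl

theorem mem_ind_iff (u : SMon) (a : ℕ) : a ∈ u.ind ↔ a ∈ u.S ∨ u.e a ≠ 0 := by
  simp [ind]

theorem notMem_ind_iff (u : SMon) (a : ℕ) : a ∉ u.ind ↔ a ∉ u.S ∧ u.e a = 0 := by
  simp [mem_ind_iff]

theorem part_of_notMem_ind {u : SMon} {a : ℕ} (h : a ∉ u.ind) : u.part a = Sum.inl 0 := by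
  rw [notMem_ind_iff] at h
  simp [part, h]

theorem part_injective : Function.Injective part := by
  rintro ⟨S, e⟩ ⟨T, g⟩ h
  have key (a : ℕ) : (a ∈ S ↔ a ∈ T) ∧ e a = g a := by
    have ha := congrFun h a
    simp only [part] at ha
    split_ifs at ha <;> simp_all
  congr 1
  · ext a
    exact (key a).1
  · ext a
    exact (key a).2

/-- A monomial whose indices form an initial segment is determined by its dotted composition. -/
theorem eq_of_dcomp_eq_of_ind_eq_range {u v : SMon} {m n : ℕ} (hu : u.ind = Finset.range m)
    (hv : v.ind = Finset.range n) (h : u.dcomp = v.dcomp) : u = v := by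
  rw [dcomp_eq_map_part, dcomp_eq_map_part, hu, hv, Finset.sort_range, Finset.sort_range] at h
  obtain rfl : m = n := by simpa using congrArg List.length h
  rw [List.map_inj_left] at h
  apply part_injective
  ext1 a
  by_cases ha : a < m
  · exact h a (List.mem_range.2 ha)
  · rw [part_of_notMem_ind (by simpa [hu] using ha), part_of_notMem_ind (by simpa [hv] using ha)]

end SMon

theorem Finset.sort_image_of_strictMonoOn {α β : Type*} [LinearOrder α] [LinearOrder β]
    {f : α → β} {s : Finset α} (hf : StrictMonoOn f s) :
    (s.image f).sort (· ≤ ·) = (s.sort (· ≤ ·)).map f := by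
  have hsorted : ((s.sort (· ≤ ·)).map f).Pairwise (· < ·) := by
    rw [List.pairwise_map]
    refine s.sortedLT_sort.pairwise.imp_of_mem fun ha hb hab => ?_
    exact hf (by simpa using ha) (by simpa using hb) hab
  refine List.Perm.eq_of_pairwise' (Finset.pairwise_sort _ _) (hsorted.imp le_of_lt) ?_
  rw [List.perm_ext_iff_of_nodup (Finset.sort_nodup _ _) (hsorted.imp ne_of_lt)]
  simp

open SMon

theorem part_sMon {i : ℕ} {u : SMon} (h : i ∉ u.ind ∨ i + 1 ∉ u.ind) (a : ℕ) :
    (sMon i u).part (Equiv.swap i (i + 1) a) = u.part a := by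
  simp only [notMem_ind_iff] at h
  simp [sMon, h, part]

theorem ind_sMon {i : ℕ} {u : SMon} (h : i ∉ u.ind ∨ i + 1 ∉ u.ind) :
    (sMon i u).ind = u.ind.image (Equiv.swap i (i + 1)) := by
  simp only [notMem_ind_iff] at h
  ext a
  obtain ⟨a, rfl⟩ := (Equiv.swap i (i + 1)).surjective a
  simp [sMon, h, mem_ind_iff]

theorem sMon_of_mem_ind {i : ℕ} {u : SMon} (h : ¬(i ∉ u.ind ∨ i + 1 ∉ u.ind)) :
    sMon i u = u := by
  simp only [notMem_ind_iff] at h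
  exact if_neg h

theorem strictMonoOn_swap_succ {i : ℕ} {s : Set ℕ} (h : i ∉ s ∨ i + 1 ∉ s) :
    StrictMonoOn (Equiv.swap i (i + 1)) s := by
  intro a ha b hb hab
  have hne : ¬(a = i ∧ b = i + 1) := by
    rintro ⟨rfl, rfl⟩
    tauto
  simp only [Equiv.swap_apply_def]
  split_ifs <;> omega

/-- The quasisymmetrizing action preserves dotted compositions. -/
theorem dcomp_sMon (i : ℕ) (u : SMon) : (sMon i u).dcomp = u.dcomp := by
  by_cases h : i ∉ u.ind ∨ i + 1 ∉ u.ind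
  · rw [dcomp_eq_map_part, dcomp_eq_map_part, ind_sMon h,
      Finset.sort_image_of_strictMonoOn (strictMonoOn_swap_succ (by simpa using h)), List.map_map]
    exact List.map_congr_left fun a _ => part_sMon h a
  · rw [sMon_of_mem_ind h]

theorem dcomp_foldr_sMon (l : List ℕ) (u : SMon) : (l.foldr sMon u).dcomp = u.dcomp := by
  induction l with
  | nil => rfl
  | cons i l ih => rw [List.foldr_cons, dcomp_sMon, ih]

theorem sum_ind_sMon_lt {i : ℕ} {u : SMon} (hi : i ∉ u.ind) (hi' : i + 1 ∈ u.ind) :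
    ∑ a ∈ (sMon i u).ind, a < ∑ a ∈ u.ind, a := by
  rw [ind_sMon (Or.inl hi), Finset.sum_image (Equiv.injective _).injOn]
  refine Finset.sum_lt_sum (fun a ha => ?_) ⟨i + 1, hi', by simp⟩
  have hne : a ≠ i := fun h => hi (h ▸ ha)
  simp only [Equiv.swap_apply_def]
  split_ifs <;> omega

theorem Finset.exists_eq_range_of_forall_succ_mem {s : Finset ℕ} (h : ∀ i, i + 1 ∈ s → i ∈ s) :
    ∃ n, s = Finset.range n := by
  have hlow : ∀ b ∈ s, ∀ a ≤ b, a ∈ s := fun b hb a hab =>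
    Nat.decreasingInduction (motive := fun k _ => k ∈ s) (fun k _ hk => h k hk) hb hab
  obtain ⟨n, hn, hmin⟩ : ∃ n, n ∉ s ∧ ∀ m < n, m ∈ s := by
    have hex := Infinite.exists_notMem_finset s
    exact ⟨Nat.find hex, Nat.find_spec hex, fun m hm => not_not.1 (Nat.find_min hex hm)⟩
  refine ⟨n, ?_⟩
  ext a
  rw [Finset.mem_range]
  exact ⟨fun ha => not_le.1 fun hna => hn (hlow a ha n hna), hmin a⟩

/-- The quasisymmetrizing action moves every monomial to one whose indices form an initial
segment. -/
theorem exists_foldr_sMon_ind_eq_range (u : SMon) :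
    ∃ (l : List ℕ) (n : ℕ), (l.foldr sMon u).ind = Finset.range n := by
  by_cases h : ∀ i, i + 1 ∈ u.ind → i ∈ u.ind
  · exact ⟨[], Finset.exists_eq_range_of_forall_succ_mem h⟩
  · push Not at h
    obtain ⟨i, hi', hi⟩ := h
    have hlt := sum_ind_sMon_lt hi hi'
    obtain ⟨l, n, hl⟩ := exists_foldr_sMon_ind_eq_range (sMon i u)
    exact ⟨l ++ [i], n, by simpa using hl⟩
termination_by ∑ a ∈ u.ind, a

/-- **Proposition.** A bounded-degree element `f` of the supercommutative superspace
algebra `ℚ^θ[[x]]` is a quasisymmetric function in superspace (its coefficient on a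
monomial depends only on the dotted composition of that monomial) if and only if
`σ · f = f` for every `σ` in the finitary symmetric group `S_∞` (given as a word in the
adjacent transpositions) acting by the quasisymmetrizing action in superspace. -/
theorem qsym_superspace_iff_invariant
    (f : SMon → ℚ) (hf : ∃ N, ∀ u : SMon, f u ≠ 0 → u.deg ≤ N) :
    (∀ u v : SMon, u.dcomp = v.dcomp → f u = f v) ↔
      ∀ (l : List ℕ) (u : SMon), f (l.foldr sMon u) = f u := by
  refine ⟨fun h l u => h _ _ (dcomp_foldr_sMon l u), fun h u v huv => ?_⟩
  obtain ⟨l, m, hl⟩ := exists_foldr_sMon_ind_eq_range u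
  obtain ⟨k, n, hk⟩ := exists_foldr_sMon_ind_eq_range v
  rw [← h l u, ← h k v, eq_of_dcomp_eq_of_ind_eq_range hl hk]
  rw [dcomp_foldr_sMon, dcomp_foldr_sMon, huv]
end

section
/- Let I be a superpermutation. Then the map J ↦ α(J) is a poset isomorphism from the upper ideal I↑ = {J : J ⪰ I} in the poset of set supercompositions onto the lower ideal γ(I)↓ = {β : β ⪯ γ(I)} in the poset of dotted compositions. -/
/-- The set of nonzero elements appearing in the blocks of a sequence of subsets. -/
def unionNZ (I : List (Finset ℕ)) : Finset ℕ := (I.foldr (· ∪ ·) ∅).erase 0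

/-- A set supercomposition: a sequence of nonempty subsets of `{0, …, n}`, pairwise
intersecting in at most `{0}`, whose union minus `{0}` equals `{1, …, n}`. Blocks
containing `0` are the fermionic blocks. -/
def IsSSC (I : List (Finset ℕ)) : Prop :=
  (∀ B ∈ I, B.Nonempty) ∧ I.Pairwise (fun B C => B ∩ C ⊆ {0}) ∧
    unionNZ I = Finset.Icc 1 (unionNZ I).card

/-- Covering relation on set supercompositions: merge two adjacent non-fermionic blocks,
every element of the first being smaller than every element of the second. -/
inductive SSCover : List (Finset ℕ) → List (Finset ℕ) → Prop
  | mk (pre post : List (Finset ℕ)) (B C : Finset ℕ) :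
      0 ∉ B → 0 ∉ C → (∀ b ∈ B, ∀ c ∈ C, b < c) →
      SSCover (pre ++ B :: C :: post) (pre ++ (B ∪ C) :: post)

/-- The partial order on set supercompositions (reflexive-transitive closure of covering). -/
def SSle : List (Finset ℕ) → List (Finset ℕ) → Prop := Relation.ReflTransGen SSCover

/-- A superpermutation: a set supercomposition all of whose non-fermionic blocks are
singletons. -/
def IsSuperPerm (I : List (Finset ℕ)) : Prop :=
  IsSSC I ∧ ∀ B ∈ I, 0 ∉ B → B.card = 1

/-- The dotted composition `α(I)` associated with a set supercomposition: the `i`-th part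
is `|I_i|` (non-dotted) if `I_i` is non-fermionic, and the dotted `|I_i| - 1` otherwise. -/
def alphaD (I : List (Finset ℕ)) : List DPart :=
  I.map fun B => if 0 ∈ B then Sum.inr (B.card - 1) else Sum.inl B.card

/-- Covering relation on dotted compositions: merge two adjacent non-dotted parts into
their sum. -/
inductive DCCover : List DPart → List DPart → Prop
  | mk (pre post : List DPart) (a b : ℕ) :
      DCCover (pre ++ Sum.inl a :: Sum.inl b :: post) (pre ++ Sum.inl (a + b) :: post)

/-- The partial order `⪯` on dotted compositions (reflexive-transitive closure of the
covering relation). -/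
def DCle : List DPart → List DPart → Prop := Relation.ReflTransGen DCCover

/-- A dotted composition: every non-dotted part is a positive integer. -/
def IsDC (α : List DPart) : Prop := ∀ a : ℕ, (Sum.inl a : DPart) ∈ α → 0 < a

/-- The descent composition of a word: the composition recording the lengths of the
maximal increasing runs. -/
def descComp (as : List ℕ) : List ℕ :=
  if as.length = 0 then []
  else
    let D := (Finset.range as.length).filter fun i => 1 ≤ i ∧ as.getD i 0 < as.getD (i - 1) 0
    let l := D.sort (· ≤ ·) ++ [as.length]
    ((0 :: l).zip l).map fun p => p.2 - p.1

/-- The unique element of a (singleton) block. -/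
def elt (B : Finset ℕ) : ℕ := if h : B.Nonempty then B.min' h else 0

/-- Auxiliary recursion for `gamma`: scan the blocks, accumulating the word of the current
non-fermionic segment, flushing its descent composition when a fermionic block is met. -/
def gammaAux : List (Finset ℕ) → List ℕ → List DPart
  | [], run => (descComp run).map (Sum.inl : ℕ → DPart)
  | B :: rest, run =>
    if 0 ∈ B then
      (descComp run).map (Sum.inl : ℕ → DPart) ++ Sum.inr (B.card - 1) :: gammaAux rest []
    else gammaAux rest (run ++ [elt B])

/-- The dotted composition `γ(I)` of a superpermutation: concatenate, in order along `I`,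
the dotted parts `(|I_i| - 1)˙` for the fermionic blocks and the descent compositions of
the maximal non-fermionic segments. -/
def gamma (I : List (Finset ℕ)) : List DPart := gammaAux I []

/-- Structural description of the order on set supercompositions. -/
inductive SSUp : List (Finset ℕ) → List (Finset ℕ) → Prop
  | nil : SSUp [] []
  | cons {I J : List (Finset ℕ)} (B : Finset ℕ) : SSUp I J → SSUp (B :: I) (B :: J)
  | merge {I J : List (Finset ℕ)} {B C : Finset ℕ} : SSUp I (C :: J) → 0 ∉ B → 0 ∉ C →
      (∀ b ∈ B, ∀ c ∈ C, b < c) → SSUp (B :: I) ((B ∪ C) :: J)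

/-- Structural description of the order on dotted compositions. -/
inductive DCUp : List DPart → List DPart → Prop
  | nil : DCUp [] []
  | cons {α β : List DPart} (x : DPart) : DCUp α β → DCUp (x :: α) (x :: β)
  | merge {α β : List DPart} {a b : ℕ} : DCUp α (Sum.inl b :: β) →
      DCUp (Sum.inl a :: α) (Sum.inl (a + b) :: β)

theorem SSUp.refl : ∀ I, SSUp I I
  | [] => .nil
  | B :: I => .cons B (SSUp.refl I)

theorem DCUp.refl : ∀ α, DCUp α α
  | [] => .nil
  | x :: α => .cons x (DCUp.refl α)

theorem SSle.cons {I J : List (Finset ℕ)} (B : Finset ℕ) (h : SSle I J) :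
    SSle (B :: I) (B :: J) := by
  refine Relation.ReflTransGen.lift (B :: ·) ?_ _ _ h
  rintro _ _ ⟨pre, post, C, D, hC, hD, hCD⟩
  exact SSCover.mk (B :: pre) post C D hC hD hCD

theorem DCle.cons {α β : List DPart} (x : DPart) (h : DCle α β) :
    DCle (x :: α) (x :: β) := by
  refine Relation.ReflTransGen.lift (x :: ·) ?_ _ _ h
  rintro _ _ ⟨pre, post, a, b⟩
  exact DCCover.mk (x :: pre) post a b

theorem SSUp.sSle {I J : List (Finset ℕ)} (h : SSUp I J) : SSle I J := by
  induction h with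
  | nil => exact .refl
  | cons B _ ih => exact ih.cons B
  | merge _ hB hC hBC ih => exact (ih.cons _).tail (SSCover.mk [] _ _ _ hB hC hBC)

theorem DCUp.dCle {α β : List DPart} (h : DCUp α β) : DCle α β := by
  induction h with
  | nil => exact .refl
  | cons x _ ih => exact ih.cons x
  | merge _ ih => exact (ih.cons _).tail (DCCover.mk [] _ _ _)

theorem SSUp.tail {I J K : List (Finset ℕ)} (h : SSUp I J) (hJK : SSCover J K) : SSUp I K := by
  obtain ⟨pre, post, B, C, hB, hC, hBC⟩ := hJK
  generalize hL : pre ++ B :: C :: post = L at h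
  induction h generalizing pre B with
  | nil => simp at hL
  | cons D h ih =>
    cases pre with
    | nil =>
      simp only [List.nil_append, List.cons.injEq] at hL
      obtain ⟨rfl, rfl⟩ := hL
      exact .merge h hB hC hBC
    | cons E pre =>
      simp only [List.cons_append, List.cons.injEq] at hL
      obtain ⟨rfl, rfl⟩ := hL
      exact .cons _ (ih pre B hB hBC rfl)
  | @merge I' J' D E h hD hE hDE ih =>
    cases pre with
    | nil =>
      simp only [List.nil_append, List.cons.injEq] at hL
      obtain ⟨rfl, rfl⟩ := hL
      have h' := ih [] E hE (fun b hb c hc => hBC b (by simp [hb]) c hc) rfl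
      simp only [List.nil_append] at h' ⊢
      rw [Finset.union_assoc]
      refine .merge h' hD (by simp [hE, hC]) fun b hb c hc => ?_
      rcases Finset.mem_union.1 hc with hc | hc
      · exact hDE b hb c hc
      · exact hBC b (by simp [hb]) c hc
    | cons F pre =>
      simp only [List.cons_append, List.cons.injEq] at hL
      obtain ⟨rfl, rfl⟩ := hL
      exact .merge (ih (E :: pre) B hB hBC rfl) hD hE hDE

theorem DCUp.tail {α β γ : List DPart} (h : DCUp α β) (hβγ : DCCover β γ) : DCUp α γ := by
  obtain ⟨pre, post, a, b⟩ := hβγ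
  generalize hL : pre ++ Sum.inl a :: Sum.inl b :: post = L at h
  induction h generalizing pre a with
  | nil => simp at hL
  | cons x h ih =>
    cases pre with
    | nil =>
      simp only [List.nil_append, List.cons.injEq] at hL
      obtain ⟨rfl, rfl⟩ := hL
      exact .merge h
    | cons y pre =>
      simp only [List.cons_append, List.cons.injEq] at hL
      obtain ⟨rfl, rfl⟩ := hL
      exact .cons _ (ih pre a rfl)
  | @merge α' β' c d h ih =>
    cases pre with
    | nil =>
      simp only [List.nil_append, List.cons.injEq, Sum.inl.injEq] at hL
      obtain ⟨rfl, rfl⟩ := hL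
      have h' := ih [] d rfl
      simp only [List.nil_append] at h' ⊢
      rw [add_assoc]
      exact .merge h'
    | cons y pre =>
      simp only [List.cons_append, List.cons.injEq] at hL
      obtain ⟨rfl, rfl⟩ := hL
      exact .merge (ih (Sum.inl d :: pre) a rfl)

theorem sSle_iff_sSUp {I J : List (Finset ℕ)} : SSle I J ↔ SSUp I J := by
  refine ⟨fun h => ?_, SSUp.sSle⟩
  induction h with
  | refl => exact .refl I
  | tail _ h ih => exact ih.tail h

theorem dCle_iff_dCUp {α β : List DPart} : DCle α β ↔ DCUp α β := by
  refine ⟨fun h => ?_, DCUp.dCle⟩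
  induction h with
  | refl => exact .refl α
  | tail _ h ih => exact ih.tail h

/-- The dotted part associated with a single block. -/
def blockPart (B : Finset ℕ) : DPart := if 0 ∈ B then Sum.inr (B.card - 1) else Sum.inl B.card

theorem alphaD_cons (B : Finset ℕ) (I : List (Finset ℕ)) :
    alphaD (B :: I) = blockPart B :: alphaD I := rfl

theorem blockPart_of_notMem {B : Finset ℕ} (hB : 0 ∉ B) : blockPart B = Sum.inl B.card :=
  if_neg hB

theorem blockPart_union {B C : Finset ℕ} (hB : 0 ∉ B) (hC : 0 ∉ C)
    (hBC : ∀ b ∈ B, ∀ c ∈ C, b < c) : blockPart (B ∪ C) = Sum.inl (B.card + C.card) := by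
  rw [blockPart_of_notMem (by simp [hB, hC]), Finset.card_union_of_disjoint]
  exact Finset.disjoint_left.2 fun x hx hx' => lt_irrefl x (hBC x hx x hx')

theorem SSUp.alphaD {J K : List (Finset ℕ)} (h : SSUp J K) : DCUp (alphaD J) (alphaD K) := by
  induction h with
  | nil => exact .nil
  | cons B _ ih => exact .cons _ ih
  | merge _ hB hC hBC ih =>
    rw [alphaD_cons, alphaD_cons, blockPart_union hB hC hBC, blockPart_of_notMem hB]
    rw [alphaD_cons, blockPart_of_notMem hC] at ih
    exact .merge ih

theorem SSUp.exists_cons {I J : List (Finset ℕ)} {B : Finset ℕ} (h : SSUp (B :: I) J) :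
    ∃ C K, J = C :: K ∧
      (C = B ∨ ∃ D, C = B ∪ D ∧ 0 ∉ B ∧ 0 ∉ D ∧ ∀ b ∈ B, ∀ d ∈ D, b < d) := by
  cases h with
  | cons _ h => exact ⟨_, _, rfl, .inl rfl⟩
  | merge h hB hC hBC => exact ⟨_, _, rfl, .inr ⟨_, rfl, hB, hC, hBC⟩⟩

theorem SSUp.head_subset {I J : List (Finset ℕ)} {B C : Finset ℕ} (h : SSUp (B :: I) (C :: J)) :
    B ⊆ C := by
  obtain ⟨_, _, hCJ, rfl | ⟨D, rfl, -⟩⟩ := h.exists_cons <;>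
    obtain ⟨rfl, rfl⟩ := List.cons.inj hCJ
  · exact subset_rfl
  · exact Finset.subset_union_left

theorem SSUp.exists_cons_left {I J : List (Finset ℕ)} {C : Finset ℕ} (h : SSUp I (C :: J)) :
    ∃ B K, I = B :: K := by
  cases h <;> exact ⟨_, _, rfl⟩

theorem SSUp.union {I J : List (Finset ℕ)} {B C D : Finset ℕ} (h : SSUp (C :: I) (D :: J))
    (hB : 0 ∉ B) (hBD : ∀ b ∈ B, ∀ d ∈ D, b < d) :
    SSUp ((B ∪ C) :: I) ((B ∪ D) :: J) := by
  cases h with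
  | cons _ h => exact .cons _ h
  | @merge _ _ _ E h hC hE hCE =>
    rw [← Finset.union_assoc]
    refine .merge h (by simp [hB, hC]) hE fun b hb e he => ?_
    rcases Finset.mem_union.1 hb with hb | hb
    · exact hBD b hb e (by simp [he])
    · exact hCE b hb e he

theorem SSUp.nonempty {I J : List (Finset ℕ)} (h : SSUp I J) (hI : ∀ B ∈ I, B.Nonempty) :
    ∀ B ∈ J, B.Nonempty := by
  induction h with
  | nil => simp
  | cons B _ ih => simp_all
  | merge _ _ _ _ ih =>
    simp only [List.forall_mem_cons] at hI ih ⊢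
    exact ⟨hI.1.mono Finset.subset_union_left, (ih hI.2).2⟩

theorem isDC_alphaD {J : List (Finset ℕ)} (hJ : ∀ B ∈ J, B.Nonempty) : IsDC (alphaD J) := by
  intro a ha
  obtain ⟨B, hB, h⟩ := List.mem_map.1 ha
  split_ifs at h with h0
  obtain rfl := Sum.inl.inj h
  exact (hJ B hB).card_pos

theorem IsDC.of_cons {x : DPart} {α : List DPart} (h : IsDC (x :: α)) : IsDC α :=
  fun a ha => h a (List.mem_cons_of_mem _ ha)

theorem IsDC.cons_inl {a : ℕ} {α : List DPart} (h : IsDC α) (ha : 0 < a) :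
    IsDC (Sum.inl a :: α) := by
  intro b hb
  rcases List.mem_cons.1 hb with hb | hb
  · rwa [Sum.inl.inj hb]
  · exact h b hb

theorem DCUp.isDC {α β : List DPart} (h : DCUp α β) (hα : IsDC α) : IsDC β := by
  induction h with
  | nil => exact hα
  | cons x _ ih =>
    intro a ha
    rcases List.mem_cons.1 ha with rfl | ha
    · exact hα a (by simp)
    · exact ih hα.of_cons a ha
  | merge _ ih =>
    exact (ih hα.of_cons).of_cons.cons_inl (Nat.add_pos_left (hα _ (by simp)) _)

theorem SSUp.eq_of_alphaD_eq {I J K : List (Finset ℕ)} (hne : ∀ B ∈ I, B.Nonempty)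
    (hI : ∀ B ∈ I, 0 ∉ B → B.card = 1) (hJ : SSUp I J) (hK : SSUp I K)
    (h : _root_.alphaD J = _root_.alphaD K) : J = K := by
  induction I generalizing J K with
  | nil => cases hJ; cases hK; rfl
  | cons B I ih =>
    rw [List.forall_mem_cons] at hne hI
    cases hJ with
    | cons _ hJ =>
      cases hK with
      | cons _ hK =>
        simp only [alphaD_cons, List.cons.injEq, true_and] at h
        rw [ih hne.2 hI.2 hJ hK h]
      | merge hK hB hC hBC =>
        simp only [alphaD_cons, List.cons.injEq, blockPart_of_notMem hB,
          blockPart_union hB hC hBC, Sum.inl.injEq] at h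
        have := (hK.nonempty hne.2 _ List.mem_cons_self).card_pos
        omega
    | merge hJ hB hC hBC =>
      cases hK with
      | cons _ hK =>
        simp only [alphaD_cons, List.cons.injEq, blockPart_of_notMem hB,
          blockPart_union hB hC hBC, Sum.inl.injEq] at h
        have := (hJ.nonempty hne.2 _ List.mem_cons_self).card_pos
        omega
      | merge hK _ hD hBD =>
        simp only [alphaD_cons, List.cons.injEq, blockPart_union hB hD hBD,
          blockPart_union hB hC hBC, Sum.inl.injEq, add_right_inj] at h
        obtain ⟨rfl, rfl⟩ := List.cons.inj (ih hne.2 hI.2 hJ hK (by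
          simp only [alphaD_cons, blockPart_of_notMem hC, blockPart_of_notMem hD, h.1, h.2]))
        rfl

theorem DCUp.exists_of_succ {β γ : List DPart} {m : ℕ} (hβ : IsDC β) (hm : 0 < m)
    (h : DCUp β (Sum.inl (1 + m) :: γ)) :
    (∃ δ, β = Sum.inl 1 :: δ ∧ DCUp δ (Sum.inl m :: γ)) ∨
      ∃ a δ, 0 < a ∧ β = Sum.inl (1 + a) :: δ ∧ DCUp (Sum.inl a :: δ) (Sum.inl m :: γ) := by
  generalize hL : Sum.inl (1 + m) :: γ = L at h
  cases h with
  | nil => simp at hL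
  | cons x h =>
    obtain ⟨rfl, rfl⟩ := List.cons.inj hL
    exact .inr ⟨m, _, hm, rfl, .cons _ h⟩
  | @merge _ _ a b h =>
    simp only [List.cons.injEq, Sum.inl.injEq] at hL
    obtain ⟨hab, rfl⟩ := hL
    have ha := hβ a (by simp)
    rcases Nat.lt_or_ge 1 a with h1 | h1
    · obtain ⟨c, rfl⟩ := Nat.exists_eq_add_of_lt h1
      obtain rfl : m = c + 1 + b := by omega
      exact .inr ⟨c + 1, _, by omega, rfl, .merge h⟩
    · obtain rfl : a = 1 := by omega
      obtain rfl : m = b := by omega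
      exact .inl ⟨_, rfl, h⟩

theorem SSUp.exists_of_dCUp {I K : List (Finset ℕ)} {β : List DPart}
    (hne : ∀ B ∈ I, B.Nonempty) (hI : ∀ B ∈ I, 0 ∉ B → B.card = 1) (hK : SSUp I K)
    (hβ : IsDC β) (h : DCUp β (_root_.alphaD K)) :
    ∃ J, SSUp I J ∧ SSUp J K ∧ _root_.alphaD J = β := by
  induction hK generalizing β with
  | nil => cases h; exact ⟨[], .nil, .nil, rfl⟩
  | cons B hK ih =>
    rw [List.forall_mem_cons] at hne hI
    rw [alphaD_cons] at h
    generalize hx : blockPart B = x at h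
    cases h with
    | cons _ h =>
      obtain ⟨J, h₁, h₂, h₃⟩ := ih hne.2 hI.2 hβ.of_cons h
      exact ⟨B :: J, .cons _ h₁, .cons _ h₂, by rw [alphaD_cons, h₃, hx]⟩
    | @merge _ _ a b h =>
      exfalso
      have ha := hβ a (by simp)
      have hb := h.isDC hβ.of_cons b (by simp)
      unfold blockPart at hx
      split_ifs at hx with h0
      have := Sum.inl.inj hx
      have := hI.1 h0
      omega
  | @merge I' K' B C hK hB hC hBC ih =>
    rw [List.forall_mem_cons] at hne hI
    rw [alphaD_cons, blockPart_union hB hC hBC, hI.1 hB] at h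
    rw [alphaD_cons, blockPart_of_notMem hC] at ih
    rcases h.exists_of_succ hβ (hK.nonempty hne.2 _ List.mem_cons_self).card_pos with
      ⟨δ, rfl, hδ⟩ | ⟨a, δ, ha, rfl, hδ⟩
    · obtain ⟨J, h₁, h₂, h₃⟩ := ih hne.2 hI.2 hβ.of_cons hδ
      refine ⟨B :: J, .cons _ h₁, .merge h₂ hB hC hBC, ?_⟩
      rw [alphaD_cons, h₃, blockPart_of_notMem hB, hI.1 hB]
    · obtain ⟨J, h₁, h₂, h₃⟩ := ih hne.2 hI.2 (hβ.of_cons.cons_inl ha) hδ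
      obtain ⟨D, J, rfl⟩ := h₂.exists_cons_left
      have hDC := h₂.head_subset
      have hD : 0 ∉ D := fun h0 => hC (hDC h0)
      have hBD : ∀ b ∈ B, ∀ d ∈ D, b < d := fun b hb d hd => hBC b hb d (hDC hd)
      refine ⟨(B ∪ D) :: J, .merge h₁ hB hD hBD, h₂.union hB hBC, ?_⟩
      simp only [alphaD_cons, blockPart_of_notMem hD, List.cons.injEq, Sum.inl.injEq] at h₃
      rw [alphaD_cons, blockPart_union hB hD hBD, hI.1 hB, h₃.1, h₃.2]

/-- The block `B` can be merged into the first block of the list. -/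
def Ascends (B : Finset ℕ) : List (Finset ℕ) → Prop
  | [] => False
  | C :: _ => 0 ∉ B ∧ 0 ∉ C ∧ elt B < elt C

/-- Unite `B` with the first block of the list. -/
def absorb (B : Finset ℕ) : List (Finset ℕ) → List (Finset ℕ)
  | [] => [B]
  | C :: I => (B ∪ C) :: I

open Classical in
/-- The largest set supercomposition above a superpermutation: every maximal increasing run of
non-fermionic blocks is merged into a single block. -/
noncomputable def maxSSC : List (Finset ℕ) → List (Finset ℕ)
  | [] => []
  | B :: I => if Ascends B I then absorb B (maxSSC I) else B :: maxSSC I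

theorem eq_singleton_elt {B : Finset ℕ} (hB : B.card = 1) : B = {elt B} := by
  obtain ⟨a, rfl⟩ := Finset.card_eq_one.1 hB
  simp [elt]

theorem SSUp.of_ascends {I J : List (Finset ℕ)} {B : Finset ℕ} (hB1 : 0 ∉ B → B.card = 1)
    (hI : ∀ B ∈ I, 0 ∉ B → B.card = 1) (h : SSUp I J) (ha : Ascends B I) :
    ∃ C K, J = C :: K ∧ 0 ∉ B ∧ 0 ∉ C ∧ ∀ b ∈ B, ∀ c ∈ C, b < c := by
  cases I with
  | nil => exact ha.elim
  | cons D I =>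
    obtain ⟨hB, hD, hlt⟩ := ha
    have hBD : ∀ b ∈ B, ∀ d ∈ D, b < d := by
      rw [eq_singleton_elt (hB1 hB), eq_singleton_elt (hI D (by simp) hD)]
      simpa using hlt
    obtain ⟨C, K, rfl, rfl | ⟨E, rfl, -, hE, hDE⟩⟩ := h.exists_cons
    · exact ⟨_, _, rfl, hB, hD, hBD⟩
    · refine ⟨_, _, rfl, hB, by simp [hD, hE], fun b hb c hc => ?_⟩
      rcases Finset.mem_union.1 hc with hc | hc
      · exact hBD b hb c hc
      · have hd : elt D ∈ D := by
          rw [eq_singleton_elt (hI D (by simp) hD)]; simp [elt]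
        exact (hBD b hb _ hd).trans (hDE _ hd c hc)

theorem sSUp_maxSSC {I : List (Finset ℕ)} (hI : ∀ B ∈ I, 0 ∉ B → B.card = 1) :
    SSUp I (maxSSC I) := by
  induction I with
  | nil => exact .nil
  | cons B I ih =>
    rw [List.forall_mem_cons] at hI
    have h := ih hI.2
    unfold maxSSC
    split_ifs with ha
    · obtain ⟨C, K, hK, hB, hC, hBC⟩ := h.of_ascends hI.1 hI.2 ha
      rw [hK] at h ⊢
      exact .merge h hB hC hBC
    · exact .cons _ h

theorem alphaD_maxSSC_of_ascends {I : List (Finset ℕ)} {B : Finset ℕ}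
    (hI : ∀ C ∈ B :: I, 0 ∉ C → C.card = 1) (ha : Ascends B I) :
    ∃ m γ, alphaD (maxSSC I) = Sum.inl m :: γ ∧
      alphaD (maxSSC (B :: I)) = Sum.inl (1 + m) :: γ := by
  rw [List.forall_mem_cons] at hI
  obtain ⟨C, K, hK, hB, hC, hBC⟩ := (sSUp_maxSSC hI.2).of_ascends hI.1 hI.2 ha
  refine ⟨C.card, alphaD K, ?_, ?_⟩
  · rw [hK, alphaD_cons, blockPart_of_notMem hC]
  · rw [maxSSC, if_pos ha, hK, absorb, alphaD_cons, blockPart_union hB hC hBC, hI.1 hB]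

theorem SSUp.maxSSC {I J : List (Finset ℕ)} (hI : ∀ B ∈ I, 0 ∉ B → B.card = 1)
    (h : SSUp I J) : SSUp J (maxSSC I) := by
  induction h with
  | nil => exact .nil
  | @cons I J B _ ih =>
    rw [List.forall_mem_cons] at hI
    have h := ih hI.2
    unfold _root_.maxSSC
    split_ifs with ha
    · obtain ⟨C, K, hK, hB, hC, hBC⟩ := (sSUp_maxSSC hI.2).of_ascends hI.1 hI.2 ha
      rw [hK] at h ⊢
      exact .merge h hB hC hBC
    · exact .cons _ h
  | @merge I J B C hIJ hB hC hBC ih =>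
    rw [List.forall_mem_cons] at hI
    have h := ih hI.2
    have ha : Ascends B I := by
      obtain ⟨D, I, rfl⟩ := hIJ.exists_cons_left
      have hDC := hIJ.head_subset
      have hD : 0 ∉ D := fun h0 => hC (hDC h0)
      refine ⟨hB, hD, hBC _ ?_ _ (hDC ?_)⟩
      · rw [eq_singleton_elt (hI.1 hB)]; simp [elt]
      · rw [eq_singleton_elt (hI.2 D (by simp) hD)]; simp [elt]
    obtain ⟨E, K, hK, -, hE, hBE⟩ := (sSUp_maxSSC hI.2).of_ascends hI.1 hI.2 ha
    rw [_root_.maxSSC, if_pos ha]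
    rw [hK] at h ⊢
    exact h.union hB hBE

/-- The positions of the descents of a word, in increasing order, followed by its length. -/
def descents (as : List ℕ) : List ℕ :=
  (List.range as.length).filter (fun i => 1 ≤ i ∧ as.getD i 0 < as.getD (i - 1) 0) ++ [as.length]

/-- The consecutive differences of `k :: l`. -/
def gaps (k : ℕ) (l : List ℕ) : List ℕ := ((k :: l).zip l).map fun p => p.2 - p.1

theorem gaps_cons (k a : ℕ) (l : List ℕ) : gaps k (a :: l) = (a - k) :: gaps a l := rfl

theorem gaps_map_succ (k : ℕ) (l : List ℕ) : gaps (k + 1) (l.map Nat.succ) = gaps k l := by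
  induction l generalizing k with
  | nil => rfl
  | cons a l ih => simp [gaps_cons, ih]

theorem descComp_eq_gaps {as : List ℕ} (h : as ≠ []) : descComp as = gaps 0 (descents as) := by
  have hs : ∀ (n : ℕ) (p : ℕ → Prop) [DecidablePred p],
      ((Finset.range n).filter p).sort (· ≤ ·) = (List.range n).filter p := by
    intro n p _
    have hp : ((List.range n).filter p).Pairwise (· < ·) :=
      List.Pairwise.filter _ List.pairwise_lt_range
    have hf : (Finset.range n).filter p = ((List.range n).filter p).toFinset := by
      ext; simp
    rw [hf]
    exact (List.toFinset_sort (· ≤ ·) (hp.imp ne_of_lt)).2 (hp.imp le_of_lt)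
  unfold descComp
  rw [if_neg (by simpa using h)]
  simp only [hs]
  rfl

theorem descents_cons_cons (a b : ℕ) (l : List ℕ) :
    descents (a :: b :: l) =
      (if b < a then [1] else []) ++ (descents (b :: l)).map Nat.succ := by
  simp only [descents, List.length_cons, List.range_succ_eq_map, List.map_cons, List.filter_cons,
    List.filter_map, List.map_append, List.map_map]
  split_ifs <;> simp_all [Function.comp_def]

theorem descComp_nil : descComp [] = [] := rfl

theorem descComp_singleton (a : ℕ) : descComp [a] = [1] := by
  rw [descComp_eq_gaps (by simp)]
  simp [descents, gaps]

theorem descComp_of_lt {a b : ℕ} (l : List ℕ) (h : b < a) :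
    descComp (a :: b :: l) = 1 :: descComp (b :: l) := by
  rw [descComp_eq_gaps (by simp), descComp_eq_gaps (by simp), descents_cons_cons, if_pos h]
  simp only [List.cons_append, List.nil_append, gaps_cons]
  rw [← gaps_map_succ 0]

theorem descComp_of_not_lt {a b : ℕ} (l : List ℕ) (h : ¬ b < a) :
    ∃ m c, descComp (b :: l) = m :: c ∧ descComp (a :: b :: l) = (1 + m) :: c := by
  rw [descComp_eq_gaps (by simp), descComp_eq_gaps (by simp), descents_cons_cons, if_neg h]
  obtain ⟨r, R, hR⟩ := List.exists_cons_of_ne_nil (show descents (b :: l) ≠ [] by simp [descents])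
  rw [hR]
  refine ⟨r, gaps r R, rfl, ?_⟩
  simp only [List.nil_append, List.map_cons, gaps_cons, gaps_map_succ, Nat.succ_eq_add_one,
    Nat.sub_zero, add_comm]

theorem elt_singleton (a : ℕ) : elt {a} = a := by simp [elt]

theorem alphaD_maxSSC_append {run : List ℕ} {L : List (Finset ℕ)} (h0 : 0 ∉ run)
    (hrun : run.Nodup) (hL : ∀ B I, L = B :: I → 0 ∈ B)
    (hL1 : ∀ B ∈ L, 0 ∉ B → B.card = 1) :
    alphaD (maxSSC (run.map singleton ++ L)) =
      (descComp run).map Sum.inl ++ alphaD (maxSSC L) := by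
  induction run with
  | nil => simp [descComp_nil]
  | cons a run ih =>
    simp only [List.mem_cons, not_or] at h0
    have h := ih h0.2 hrun.of_cons
    have ha : 0 ∉ ({a} : Finset ℕ) := by simpa using h0.1
    cases run with
    | nil =>
      have hna : ¬ Ascends {a} L := by
        cases L with
        | nil => exact id
        | cons B I => exact fun h => h.2.1 (hL B I rfl)
      simp [maxSSC, hna, descComp_singleton, alphaD_cons, blockPart_of_notMem ha]
    | cons b run =>
      simp only [List.mem_cons, not_or] at h0
      have hb : 0 ∉ ({b} : Finset ℕ) := by simpa using h0.2.1
      have hab : a ≠ b := by rintro rfl; simp at hrun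
      have hasc : Ascends {a} (List.map singleton (b :: run) ++ L) ↔ a < b := by
        simp [Ascends, elt_singleton, h0.1, h0.2.1]
      rcases Nat.lt_or_gt_of_ne hab with hlt | hlt
      · have hcard : ∀ C ∈ {a} :: (List.map singleton (b :: run) ++ L), 0 ∉ C → C.card = 1 := by
          intro C hC h0C
          simp only [List.mem_cons, List.mem_append, List.mem_map] at hC
          rcases hC with rfl | ⟨x, -, rfl⟩ | hC
          · simp
          · simp
          · exact hL1 C hC h0C
        obtain ⟨k, δ, h₃, h₄⟩ := alphaD_maxSSC_of_ascends hcard (hasc.2 hlt)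
        obtain ⟨m, c, h₁, h₂⟩ := descComp_of_not_lt run hlt.not_gt
        rw [h₃, h₁, List.map_cons, List.cons_append] at h
        simp only [List.cons.injEq, Sum.inl.injEq] at h
        rw [List.map_cons, List.cons_append, h₄, h₂, h.1, h.2]
        rfl
      · rw [List.map_cons, List.cons_append, maxSSC, if_neg (by rw [hasc]; omega), alphaD_cons, h, blockPart_of_notMem ha,
          descComp_of_lt run hlt]
        simp

theorem gammaAux_eq {I : List (Finset ℕ)} {run : List ℕ} (h0 : 0 ∉ run) (hrun : run.Nodup)
    (hI : ∀ B ∈ I, 0 ∉ B → B.card = 1) (hp : I.Pairwise (fun B C => B ∩ C ⊆ {0}))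
    (hd : ∀ a ∈ run, ∀ B ∈ I, a ∉ B) :
    gammaAux I run = alphaD (maxSSC (run.map singleton ++ I)) := by
  induction I generalizing run with
  | nil => rw [alphaD_maxSSC_append h0 hrun (by simp) (by simp)]; simp [gammaAux, maxSSC, alphaD]
  | cons B I ih =>
    rw [List.forall_mem_cons] at hI
    rw [List.pairwise_cons] at hp
    unfold gammaAux
    split_ifs with hB
    · rw [alphaD_maxSSC_append h0 hrun (by simpa using hB)
        (List.forall_mem_cons.2 hI), ih (by simp) (by simp) hI.2 hp.2 (by simp)]
      have hna : ¬ Ascends B I := by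
        cases I with
        | nil => exact id
        | cons C I => exact fun h => h.1 hB
      simp [maxSSC, hna, alphaD_cons, blockPart, hB]
    · have hBe := eq_singleton_elt (hI.1 hB)
      have he : elt B ∈ B := by rw [hBe]; simp [elt]
      have he0 : elt B ≠ 0 := fun h => hB (h ▸ he)
      rw [ih (run := run ++ [elt B]) ?_ ?_ hI.2 hp.2 ?_]
      · simp [← hBe]
      · simp [h0, he0.symm]
      · rw [List.nodup_append]
        refine ⟨hrun, by simp, fun a ha b hb hab => hd a ha B (by simp) ?_⟩
        rw [hab, List.mem_singleton.1 hb]; exact he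
      · intro a ha C hC haC
        rcases List.mem_append.1 ha with ha | ha
        · exact hd a ha C (by simp [hC]) haC
        · obtain rfl := List.mem_singleton.1 ha
          exact he0 (by simpa using hp.1 C hC (Finset.mem_inter.2 ⟨he, haC⟩))

theorem gamma_eq_alphaD_maxSSC {I : List (Finset ℕ)} (hI : IsSuperPerm I) :
    gamma I = alphaD (maxSSC I) :=
  gammaAux_eq (run := []) (by simp) (by simp) hI.2 hI.1.2.1 (by simp)

/-- **Proposition.** Let `I` be a superpermutation. Then the map `J ↦ α(J)` is a poset
isomorphism from the upper ideal `I↑ = {J : J ⪰ I}` in the poset of set supercompositions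
onto the lower ideal `γ(I)↓ = {β : β ⪯ γ(I)}` in the poset of dotted compositions. -/
theorem upper_ideal_iso_dotted_composition (I : List (Finset ℕ)) (hI : IsSuperPerm I) :
    ∃ e : {J : List (Finset ℕ) // SSle I J} ≃
          {β : List DPart // IsDC β ∧ DCle β (gamma I)},
      (∀ J, (e J).val = alphaD J.val) ∧
        ∀ J K, SSle J.val K.val ↔ DCle (e J).val (e K).val := by
  have hne := hI.1.1
  have hup : ∀ J : {J : List (Finset ℕ) // SSle I J}, SSUp I J.1 := fun J => sSle_iff_sSUp.1 J.2
  let f : {J : List (Finset ℕ) // SSle I J} →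
      {β : List DPart // IsDC β ∧ DCle β (gamma I)} := fun J =>
    ⟨alphaD J.1, isDC_alphaD ((hup J).nonempty hne), by
      rw [gamma_eq_alphaD_maxSSC hI]
      exact ((hup J).maxSSC hI.2).alphaD.dCle⟩
  have hf : Function.Bijective f := by
    refine ⟨fun J K h => Subtype.ext ?_, fun ⟨β, hβ, hle⟩ => ?_⟩
    · exact (hup J).eq_of_alphaD_eq hne hI.2 (hup K) (Subtype.ext_iff.1 h)
    · rw [gamma_eq_alphaD_maxSSC hI, dCle_iff_dCUp] at hle
      obtain ⟨J, h, -, hJ⟩ := (sSUp_maxSSC hI.2).exists_of_dCUp hne hI.2 hβ hle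
      exact ⟨⟨J, h.sSle⟩, Subtype.ext hJ⟩
  refine ⟨Equiv.ofBijective f hf, fun _ => rfl, fun J K =>
    ⟨fun h => (sSle_iff_sSUp.1 h).alphaD.dCle, fun h => ?_⟩⟩
  obtain ⟨L, h₁, h₂, h₃⟩ := (hup K).exists_of_dCUp hne hI.2
    (isDC_alphaD ((hup J).nonempty hne)) (dCle_iff_dCUp.1 h)
  rw [(hup J).eq_of_alphaD_eq hne hI.2 h₁ h₃.symm]
  exact h₂.sSle
end
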